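/- Logical subject reduction: if the logical typing Γ ⊢ m : A is derivable and m logically reduces in one step to n, then Γ ⊢ n : A is derivable. -/

import Mathlib

namespace TLL

/-- The two sorts of TLL: `U` (non-linear) and `L` (linear). -/
inductive Srt : Type
  | U | L
deriving DecidableEq

/-- TLL terms in de Bruijn representation: variables, sorts, the two Π-type
formers (irrelevant `pi0` and relevant `pi1`), the two λ-formers, application,
the erased constant `box`, and heap pointers `ptr`. -/
inductive Tm : Type
  | var  : Nat → Tm
  | srt  : Srt → Tm
  | pi0  : Srt → Tm → Tm → Tm
  | pi1  : Srt → Tm → Tm → Tm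
  | lam0 : Srt → Tm → Tm → Tm
  | lam1 : Srt → Tm → Tm → Tm
  | app  : Tm → Tm → Tm
  | box  : Tm
  | ptr  : Nat → Tm

def upr (ξ : Nat → Nat) : Nat → Nat
  | 0 => 0
  | n + 1 => ξ n + 1

def rename (ξ : Nat → Nat) : Tm → Tm
  | .var x => .var (ξ x)
  | .srt s => .srt s
  | .pi0 t A B => .pi0 t (rename ξ A) (rename (upr ξ) B)
  | .pi1 t A B => .pi1 t (rename ξ A) (rename (upr ξ) B)
  | .lam0 t A m => .lam0 t (rename ξ A) (rename (upr ξ) m)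
  | .lam1 t A m => .lam1 t (rename ξ A) (rename (upr ξ) m)
  | .app m n => .app (rename ξ m) (rename ξ n)
  | .box => .box
  | .ptr l => .ptr l

def up (σ : Nat → Tm) : Nat → Tm
  | 0 => .var 0
  | n + 1 => rename Nat.succ (σ n)

def subst (σ : Nat → Tm) : Tm → Tm
  | .var x => σ x
  | .srt s => .srt s
  | .pi0 t A B => .pi0 t (subst σ A) (subst (up σ) B)
  | .pi1 t A B => .pi1 t (subst σ A) (subst (up σ) B)
  | .lam0 t A m => .lam0 t (subst σ A) (subst (up σ) m)
  | .lam1 t A m => .lam1 t (subst σ A) (subst (up σ) m)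
  | .app m n => .app (subst σ m) (subst σ n)
  | .box => .box
  | .ptr l => .ptr l

/-- `subst1 n m` is `m[n/x]` for the topmost bound variable `x`. -/
def subst1 (n : Tm) (m : Tm) : Tm :=
  subst (fun i => match i with | 0 => n | i + 1 => .var i) m

/-- Logical one-step reduction `m ~> n`: full β-reduction with both β-rules,
closed under all structural subterm positions. -/
inductive LStep : Tm → Tm → Prop
  | beta0 {t A m n} : LStep (.app (.lam0 t A m) n) (subst1 n m)
  | beta1 {t A m n} : LStep (.app (.lam1 t A m) n) (subst1 n m)
  | appL {m m' n} : LStep m m' → LStep (.app m n) (.app m' n)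
  | appR {m n n'} : LStep n n' → LStep (.app m n) (.app m n')
  | pi0A {t A A' B} : LStep A A' → LStep (.pi0 t A B) (.pi0 t A' B)
  | pi0B {t A B B'} : LStep B B' → LStep (.pi0 t A B) (.pi0 t A B')
  | pi1A {t A A' B} : LStep A A' → LStep (.pi1 t A B) (.pi1 t A' B)
  | pi1B {t A B B'} : LStep B B' → LStep (.pi1 t A B) (.pi1 t A B')
  | lam0A {t A A' m} : LStep A A' → LStep (.lam0 t A m) (.lam0 t A' m)
  | lam0M {t A m m'} : LStep m m' → LStep (.lam0 t A m) (.lam0 t A m')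
  | lam1A {t A A' m} : LStep A A' → LStep (.lam1 t A m) (.lam1 t A' m)
  | lam1M {t A m m'} : LStep m m' → LStep (.lam1 t A m) (.lam1 t A m')

/-- Multi-step logical reduction. -/
abbrev LRed : Tm → Tm → Prop := Relation.ReflTransGen LStep

/-- Definitional equality `A ≃ B`: equivalence closure of logical reduction. -/
def Conv (A B : Tm) : Prop := Relation.EqvGen LStep A B

/-- Parallel logical reduction `m ⇒ n`. -/
inductive PStep : Tm → Tm → Prop
  | var {x} : PStep (.var x) (.var x)
  | srt {s} : PStep (.srt s) (.srt s)
  | box : PStep .box .box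
  | ptr {l} : PStep (.ptr l) (.ptr l)
  | pi0 {t A A' B B'} : PStep A A' → PStep B B' → PStep (.pi0 t A B) (.pi0 t A' B')
  | pi1 {t A A' B B'} : PStep A A' → PStep B B' → PStep (.pi1 t A B) (.pi1 t A' B')
  | lam0 {t A A' m m'} : PStep A A' → PStep m m' → PStep (.lam0 t A m) (.lam0 t A' m')
  | lam1 {t A A' m m'} : PStep A A' → PStep m m' → PStep (.lam1 t A m) (.lam1 t A' m')
  | app {m m' n n'} : PStep m m' → PStep n n' → PStep (.app m n) (.app m' n')
  | beta0 {t A m m' n n'} : PStep m m' → PStep n n' →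
      PStep (.app (.lam0 t A m) n) (subst1 n' m')
  | beta1 {t A m m' n n'} : PStep m m' → PStep n n' →
      PStep (.app (.lam1 t A m) n) (subst1 n' m')

/-- Logical contexts: lists of types (de Bruijn). -/
abbrev Ctx := List Tm

/-- `Has Γ x A`: variable `x` has type `A` in logical context `Γ`
(with the appropriate de Bruijn shifts). -/
inductive Has : Ctx → Nat → Tm → Prop
  | zero {Γ A} : Has (A :: Γ) 0 (rename Nat.succ A)
  | succ {Γ x A B} : Has Γ x A → Has (B :: Γ) (x + 1) (rename Nat.succ A)

mutual
/-- Well-formed logical contexts. -/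
inductive LWf : Ctx → Prop
  | nil : LWf []
  | cons {Γ A s} : LWf Γ → LTyped Γ A (.srt s) → LWf (A :: Γ)

/-- The logical typing judgment `Γ ⊢ m : A`. -/
inductive LTyped : Ctx → Tm → Tm → Prop
  | srt {Γ} (s : Srt) : LWf Γ → LTyped Γ (.srt s) (.srt .U)
  | var {Γ x A} : LWf Γ → Has Γ x A → LTyped Γ (.var x) A
  | pi0 {Γ A B s r} (t : Srt) :
      LTyped Γ A (.srt s) → LTyped (A :: Γ) B (.srt r) →
      LTyped Γ (.pi0 t A B) (.srt t)
  | pi1 {Γ A B s r} (t : Srt) :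
      LTyped Γ A (.srt s) → LTyped (A :: Γ) B (.srt r) →
      LTyped Γ (.pi1 t A B) (.srt t)
  | lam0 {Γ A B m} (t : Srt) :
      LTyped (A :: Γ) m B → LTyped Γ (.lam0 t A m) (.pi0 t A B)
  | lam1 {Γ A B m} (t : Srt) :
      LTyped (A :: Γ) m B → LTyped Γ (.lam1 t A m) (.pi1 t A B)
  | app0 {Γ m n A B t} :
      LTyped Γ m (.pi0 t A B) → LTyped Γ n A → LTyped Γ (.app m n) (subst1 n B)
  | app1 {Γ m n A B t} :
      LTyped Γ m (.pi1 t A B) → LTyped Γ n A → LTyped Γ (.app m n) (subst1 n B)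
  | conv {Γ m A B s} :
      LTyped Γ m A → LTyped Γ B (.srt s) → Conv A B → LTyped Γ m B
end

/-- Program context entries: either absent, or a sort-annotated type. -/
abbrev Entry := Option (Srt × Tm)

/-- Program contexts, positionally aligned with the logical context. -/
abbrev PCtx := List Entry

/-- The context constraint `Δ ▷ s`. -/
inductive Restr : PCtx → Srt → Prop
  | nil {s} : Restr [] s
  | skip {Δ s} : Restr Δ s → Restr ((none : Entry) :: Δ) s
  | u {Δ A} : Restr Δ .U → Restr (some (.U, A) :: Δ) .U
  | l {Δ s A} : Restr Δ .L → Restr (some (s, A) :: Δ) .L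

/-- Context merge `Δ₁ ∪̇ Δ₂ = Δ`: contraction on shared `U` entries,
`L` entries occur on exactly one side. -/
inductive Merge : PCtx → PCtx → PCtx → Prop
  | nil : Merge [] [] []
  | contra {Δ₁ Δ₂ Δ A} : Merge Δ₁ Δ₂ Δ →
      Merge (some (.U, A) :: Δ₁) (some (.U, A) :: Δ₂) (some (.U, A) :: Δ)
  | left {Δ₁ Δ₂ Δ A} : Merge Δ₁ Δ₂ Δ →
      Merge (some (.L, A) :: Δ₁) ((none : Entry) :: Δ₂) (some (.L, A) :: Δ)
  | right {Δ₁ Δ₂ Δ A} : Merge Δ₁ Δ₂ Δ →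
      Merge ((none : Entry) :: Δ₁) (some (.L, A) :: Δ₂) (some (.L, A) :: Δ)
  | skip {Δ₁ Δ₂ Δ} : Merge Δ₁ Δ₂ Δ →
      Merge ((none : Entry) :: Δ₁) ((none : Entry) :: Δ₂) ((none : Entry) :: Δ)

/-- `PHas Δ x s A`: the entry `x :s A` occurs in `Δ` and the rest of `Δ`
satisfies `▷ U` (so no linear entry is discarded). -/
inductive PHas : PCtx → Nat → Srt → Tm → Prop
  | zero {Δ s A} : Restr Δ .U → PHas (some (s, A) :: Δ) 0 s (rename Nat.succ A)
  | succN {Δ x s A} : PHas Δ x s A → PHas ((none : Entry) :: Δ) (x + 1) s (rename Nat.succ A)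
  | succU {Δ x s A B} : PHas Δ x s A → PHas (some (.U, B) :: Δ) (x + 1) s (rename Nat.succ A)

/-- Well-formed pairs of logical and program contexts `Γ ; Δ ⊢`. -/
inductive PWf : Ctx → PCtx → Prop
  | nil : PWf [] []
  | cons {Γ Δ A s} : PWf Γ Δ → LTyped Γ A (.srt s) → PWf (A :: Γ) (some (s, A) :: Δ)
  | consN {Γ Δ A s} : PWf Γ Δ → LTyped Γ A (.srt s) → PWf (A :: Γ) ((none : Entry) :: Δ)

/-- The program typing judgment `Γ ; Δ ⊢ m : A`. -/
inductive PTyped : Ctx → PCtx → Tm → Tm → Prop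
  | var {Γ Δ x s A} : PWf Γ Δ → PHas Δ x s A → PTyped Γ Δ (.var x) A
  | lam0 {Γ Δ A B m} (t : Srt) :
      PTyped (A :: Γ) ((none : Entry) :: Δ) m B → Restr Δ t →
      PTyped Γ Δ (.lam0 t A m) (.pi0 t A B)
  | lam1 {Γ Δ A B m s} (t : Srt) :
      PTyped (A :: Γ) (some (s, A) :: Δ) m B → Restr Δ t →
      PTyped Γ Δ (.lam1 t A m) (.pi1 t A B)
  | app0 {Γ Δ m n A B t} :
      PTyped Γ Δ m (.pi0 t A B) → LTyped Γ n A →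
      PTyped Γ Δ (.app m n) (subst1 n B)
  | app1 {Γ Δ₁ Δ₂ Δ m n A B t} :
      PTyped Γ Δ₁ m (.pi1 t A B) → PTyped Γ Δ₂ n A → Merge Δ₁ Δ₂ Δ →
      PTyped Γ Δ (.app m n) (subst1 n B)
  | conv {Γ Δ m A B s} :
      PTyped Γ Δ m A → LTyped Γ B (.srt s) → Conv A B →
      PTyped Γ Δ m B

/-- Program values. -/
inductive Value : Tm → Prop
  | var {x} : Value (.var x)
  | lam0 {t A m} : Value (.lam0 t A m)
  | lam1 {t A m} : Value (.lam1 t A m)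

/-- Program (call-by-value) one-step reduction `m ~~> n`. -/
inductive CStep : Tm → Tm → Prop
  | appL {m m' n} : CStep m m' → CStep (.app m n) (.app m' n)
  | appR {m n n'} : CStep n n' → CStep (.app m n) (.app m n')
  | beta0 {t A m n} : CStep (.app (.lam0 t A m) n) (subst1 n m)
  | beta1 {t A m v} : Value v → CStep (.app (.lam1 t A m) v) (subst1 v m)

/-- The erasure judgment `Γ ; Δ ⊢ m ~ m' : A`. -/
inductive Erase : Ctx → PCtx → Tm → Tm → Tm → Prop
  | var {Γ Δ x s A} : PWf Γ Δ → PHas Δ x s A → Erase Γ Δ (.var x) (.var x) A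
  | lam0 {Γ Δ A B m m'} (t : Srt) :
      Erase (A :: Γ) ((none : Entry) :: Δ) m m' B → Restr Δ t →
      Erase Γ Δ (.lam0 t A m) (.lam0 t .box m') (.pi0 t A B)
  | lam1 {Γ Δ A B m m' s} (t : Srt) :
      Erase (A :: Γ) (some (s, A) :: Δ) m m' B → Restr Δ t →
      Erase Γ Δ (.lam1 t A m) (.lam1 t .box m') (.pi1 t A B)
  | app0 {Γ Δ m m' n A B t} :
      Erase Γ Δ m m' (.pi0 t A B) → LTyped Γ n A →
      Erase Γ Δ (.app m n) (.app m' .box) (subst1 n B)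
  | app1 {Γ Δ₁ Δ₂ Δ m m' n n' A B t} :
      Erase Γ Δ₁ m m' (.pi1 t A B) → Erase Γ Δ₂ n n' A → Merge Δ₁ Δ₂ Δ →
      Erase Γ Δ (.app m n) (.app m' n') (subst1 n B)
  | conv {Γ Δ m m' A B s} :
      Erase Γ Δ m m' A → LTyped Γ B (.srt s) → Conv A B →
      Erase Γ Δ m m' B

/-- Heaps: finite maps from locations to sort-annotated values. -/
abbrev Heap := Nat → Option (Srt × Tm)

/-- Heap lookup `Lookup H₁ l v H₂`: non-linear cells persist, linear cells
are deallocated. -/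
inductive Lookup : Heap → Nat → Tm → Heap → Prop
  | u {H l v} : H l = some (.U, v) → Lookup H l v H
  | l {H l v} : H l = some (.L, v) → Lookup H l v (Function.update H l none)

/-- Heap merge `H₁ ∪̇ H₂ = H`. -/
def HMerge (H₁ H₂ H : Heap) : Prop := ∀ l,
  (H₁ l = none ∧ H₂ l = none ∧ H l = none) ∨
  (∃ v, H₁ l = some (.U, v) ∧ H₂ l = some (.U, v) ∧ H l = some (.U, v)) ∨
  (∃ v, H₁ l = some (.L, v) ∧ H₂ l = none ∧ H l = some (.L, v)) ∨
  (∃ v, H₁ l = none ∧ H₂ l = some (.L, v) ∧ H l = some (.L, v))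

/-- The heap constraint `H ▷ s`. -/
def HRestr (H : Heap) : Srt → Prop
  | .U => ∀ l s v, H l = some (s, v) → s = Srt.U
  | .L => True

/-- Heap reduction `H ; m ~~> H' ; m'`. -/
inductive HStep : Heap → Tm → Heap → Tm → Prop
  | alloc0 {H l t m} : H l = none →
      HStep H (.lam0 t .box m) (Function.update H l (some (t, .lam0 t .box m))) (.ptr l)
  | alloc1 {H l t m} : H l = none →
      HStep H (.lam1 t .box m) (Function.update H l (some (t, .lam1 t .box m))) (.ptr l)
  | appL {H H' m m' n} : HStep H m H' m' → HStep H (.app m n) H' (.app m' n)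
  | appR {H H' m n n'} : HStep H n H' n' → HStep H (.app m n) H' (.app m n')
  | beta0 {H H' l t m n} : Lookup H l (.lam0 t .box m) H' →
      HStep H (.app (.ptr l) n) H' (subst1 .box m)
  | beta1 {H H' l₁ l₂ t m} : Lookup H l₁ (.lam1 t .box m) H' →
      HStep H (.app (.ptr l₁) (.ptr l₂)) H' (subst1 (.ptr l₂) m)

/-- Pointer resolution `H ; m ~ n`. -/
inductive Resolve : Heap → Tm → Tm → Prop
  | var {H x} : HRestr H .U → Resolve H (.var x) (.var x)
  | lam0 {H t m' m} : HRestr H t → Resolve H m' m →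
      Resolve H (.lam0 t .box m') (.lam0 t .box m)
  | lam1 {H t m' m} : HRestr H t → Resolve H m' m →
      Resolve H (.lam1 t .box m') (.lam1 t .box m)
  | app0 {H m' m} : Resolve H m' m → Resolve H (.app m' .box) (.app m .box)
  | app1 {H₁ H₂ H m' m n' n} : HMerge H₁ H₂ H →
      Resolve H₁ m' m → Resolve H₂ n' n → Resolve H (.app m' n') (.app m n)
  | ptr {H H' l v' v} : Lookup H l v' H' → Resolve H' v' v → Resolve H (.ptr l) v

/-- `ClosedUnder k m`: all free de Bruijn variables of `m` are `< k`. -/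
def ClosedUnder : Nat → Tm → Prop
  | k, .var x => x < k
  | _, .srt _ => True
  | k, .pi0 _ A B => ClosedUnder k A ∧ ClosedUnder (k + 1) B
  | k, .pi1 _ A B => ClosedUnder k A ∧ ClosedUnder (k + 1) B
  | k, .lam0 _ A m => ClosedUnder k A ∧ ClosedUnder (k + 1) m
  | k, .lam1 _ A m => ClosedUnder k A ∧ ClosedUnder (k + 1) m
  | k, .app m n => ClosedUnder k m ∧ ClosedUnder k n
  | _, .box => True
  | _, .ptr _ => True

/-- WR-heaps: heaps plausibly produced by heap reduction. -/
inductive WrHeap : Heap → Prop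
  | nil : WrHeap (fun _ => none)
  | lam0 {H l t m} : ClosedUnder 1 m → WrHeap H → H l = none →
      WrHeap (Function.update H l (some (t, .lam0 t .box m)))
  | lam1 {H l t m} : ClosedUnder 1 m → WrHeap H → H l = none →
      WrHeap (Function.update H l (some (t, .lam1 t .box m)))

/-- Well-resolved `H ⊢ a ~ b ~ c : A`. -/
def WellResolved (H : Heap) (a b c A : Tm) : Prop :=
  Erase [] [] a b A ∧ Resolve H c b

/-! ### Substitution algebra -/

theorem up_var_comp (ξ : Nat → Nat) : up (fun x => .var (ξ x)) = fun x => .var (upr ξ x) := by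
  funext x; cases x <;> rfl

theorem rename_eq_subst (m : Tm) : ∀ ξ : Nat → Nat, rename ξ m = subst (fun x => .var (ξ x)) m := by
  induction m <;> intro ξ <;> simp_all [rename, subst, up_var_comp]

theorem up_comp_upr (σ : Nat → Tm) (ξ : Nat → Nat) :
    (fun x => up σ (upr ξ x)) = up (fun x => σ (ξ x)) := by
  funext x; cases x <;> rfl

theorem subst_rename (m : Tm) : ∀ (σ : Nat → Tm) (ξ : Nat → Nat),
    subst σ (rename ξ m) = subst (fun x => σ (ξ x)) m := by
  induction m <;> intro σ ξ <;> simp_all [rename, subst, up_comp_upr]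

theorem rename_rename (ζ ξ : Nat → Nat) (m : Tm) :
    rename ζ (rename ξ m) = rename (fun x => ζ (ξ x)) m := by
  rw [rename_eq_subst _ ζ, subst_rename, rename_eq_subst]

theorem rename_upr_comp_up (ξ : Nat → Nat) (σ : Nat → Tm) :
    (fun x => rename (upr ξ) (up σ x)) = up (fun x => rename ξ (σ x)) := by
  funext x
  cases x with
  | zero => rfl
  | succ x => simp only [up, rename_rename, upr]

theorem rename_subst (m : Tm) : ∀ (ξ : Nat → Nat) (σ : Nat → Tm),
    rename ξ (subst σ m) = subst (fun x => rename ξ (σ x)) m := by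
  induction m <;> intro ξ σ <;> simp_all [rename, subst, rename_upr_comp_up]

theorem subst_up_comp_up (τ σ : Nat → Tm) :
    (fun x => subst (up τ) (up σ x)) = up (fun x => subst τ (σ x)) := by
  funext x
  cases x with
  | zero => rfl
  | succ x => simp only [up, subst_rename, rename_subst]

theorem subst_subst (m : Tm) : ∀ τ σ : Nat → Tm,
    subst τ (subst σ m) = subst (fun x => subst τ (σ x)) m := by
  induction m <;> intro τ σ <;> simp_all [subst, subst_up_comp_up]

theorem up_var : up .var = .var := by
  funext x; cases x <;> rfl

theorem subst_var (m : Tm) : subst .var m = m := by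
  induction m <;> simp_all [subst, up_var]

/-- The substitution sending variable `0` to `n` and lowering all others. -/
def scons (n : Tm) : Nat → Tm
  | 0 => n
  | i + 1 => .var i

theorem subst1_eq (n m : Tm) : subst1 n m = subst (scons n) m := rfl

theorem subst1_rename_succ (n m : Tm) : subst1 n (rename Nat.succ m) = m := by
  rw [subst1_eq, subst_rename]
  exact subst_var m

theorem subst_subst1 (σ : Nat → Tm) (n m : Tm) :
    subst σ (subst1 n m) = subst1 (subst σ n) (subst (up σ) m) := by
  simp only [subst1_eq, subst_subst]
  congr 1
  funext x
  cases x with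
  | zero => rfl
  | succ x => exact (subst1_rename_succ (subst σ n) (σ x)).symm

/-! ### Parallel reduction and confluence -/

theorem PStep.refl (m : Tm) : PStep m m := by
  induction m <;> constructor <;> assumption

theorem LStep.pstep {m n : Tm} (h : LStep m n) : PStep m n := by
  induction h <;> constructor <;> first | assumption | exact PStep.refl _

theorem PStep.subst_right {m n : Tm} (h : PStep m n) :
    ∀ σ : Nat → Tm, PStep (subst σ m) (subst σ n) := by
  induction h with
  | var => exact fun σ => .refl _
  | srt => exact fun _ => .srt
  | box => exact fun _ => .box
  | ptr => exact fun _ => .ptr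
  | pi0 _ _ ihA ihB => exact fun σ => .pi0 (ihA σ) (ihB _)
  | pi1 _ _ ihA ihB => exact fun σ => .pi1 (ihA σ) (ihB _)
  | lam0 _ _ ihA ihm => exact fun σ => .lam0 (ihA σ) (ihm _)
  | lam1 _ _ ihA ihm => exact fun σ => .lam1 (ihA σ) (ihm _)
  | app _ _ ihm ihn => exact fun σ => .app (ihm σ) (ihn σ)
  | beta0 _ _ ihm ihn => exact fun σ => by rw [subst_subst1]; exact .beta0 (ihm _) (ihn σ)
  | beta1 _ _ ihm ihn => exact fun σ => by rw [subst_subst1]; exact .beta1 (ihm _) (ihn σ)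

theorem PStep.rename {m n : Tm} (h : PStep m n) (ξ : Nat → Nat) :
    PStep (rename ξ m) (rename ξ n) := by
  simpa only [rename_eq_subst] using h.subst_right _

theorem PStep.up {σ τ : Nat → Tm} (h : ∀ x, PStep (σ x) (τ x)) (x : Nat) :
    PStep (up σ x) (up τ x) := by
  cases x with
  | zero => exact .var
  | succ x => exact (h x).rename _

theorem PStep.subst {m n : Tm} (h : PStep m n) : ∀ {σ τ : Nat → Tm},
    (∀ x, PStep (σ x) (τ x)) → PStep (subst σ m) (subst τ n) := by
  induction h with
  | var => exact fun hσ => hσ _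
  | srt => exact fun _ => .srt
  | box => exact fun _ => .box
  | ptr => exact fun _ => .ptr
  | pi0 _ _ ihA ihB => exact fun hσ => .pi0 (ihA hσ) (ihB (PStep.up hσ))
  | pi1 _ _ ihA ihB => exact fun hσ => .pi1 (ihA hσ) (ihB (PStep.up hσ))
  | lam0 _ _ ihA ihm => exact fun hσ => .lam0 (ihA hσ) (ihm (PStep.up hσ))
  | lam1 _ _ ihA ihm => exact fun hσ => .lam1 (ihA hσ) (ihm (PStep.up hσ))
  | app _ _ ihm ihn => exact fun hσ => .app (ihm hσ) (ihn hσ)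
  | beta0 _ _ ihm ihn =>
    exact fun hσ => by rw [subst_subst1]; exact .beta0 (ihm (PStep.up hσ)) (ihn hσ)
  | beta1 _ _ ihm ihn =>
    exact fun hσ => by rw [subst_subst1]; exact .beta1 (ihm (PStep.up hσ)) (ihn hσ)

theorem PStep.subst1 {m m' n n' : Tm} (hm : PStep m m') (hn : PStep n n') :
    PStep (subst1 n m) (subst1 n' m') := by
  simp only [subst1_eq]
  refine hm.subst fun x => ?_
  cases x with
  | zero => exact hn
  | succ x => exact .var

/-- Complete development: contract all redexes of a term simultaneously. -/
def develop : Tm → Tm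
  | .var x => .var x
  | .srt s => .srt s
  | .pi0 t A B => .pi0 t (develop A) (develop B)
  | .pi1 t A B => .pi1 t (develop A) (develop B)
  | .lam0 t A m => .lam0 t (develop A) (develop m)
  | .lam1 t A m => .lam1 t (develop A) (develop m)
  | .app (.lam0 _ _ m) n => subst1 (develop n) (develop m)
  | .app (.lam1 _ _ m) n => subst1 (develop n) (develop m)
  | .app m n => .app (develop m) (develop n)
  | .box => .box
  | .ptr l => .ptr l

theorem PStep.develop {m n : Tm} (h : PStep m n) : PStep n (develop m) := by
  induction h with
  | beta0 _ _ ihm ihn => exact ihm.subst1 ihn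
  | beta1 _ _ ihm ihn => exact ihm.subst1 ihn
  | @app m _ _ _ hm _ ihm ihn =>
    cases m with
    | lam0 =>
      cases hm
      cases ihm
      exact .beta0 ‹_› ihn
    | lam1 =>
      cases hm
      cases ihm
      exact .beta1 ‹_› ihn
    | _ => exact .app ihm ihn
  | _ => constructor <;> assumption

/-! ### Definitional equality -/

theorem Conv.map {f : Tm → Tm} (hf : ∀ {a b}, LStep a b → LStep (f a) (f b)) {a b : Tm}
    (h : Conv a b) : Conv (f a) (f b) := by
  induction h with
  | rel _ _ h => exact .rel _ _ (hf h)
  | refl => exact .refl _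
  | symm _ _ _ ih => exact .symm _ _ ih
  | trans _ _ _ _ _ ih₁ ih₂ => exact .trans _ _ _ ih₁ ih₂

theorem Conv.map₂ {f : Tm → Tm → Tm} (hl : ∀ {a a' b}, LStep a a' → LStep (f a b) (f a' b))
    (hr : ∀ {a b b'}, LStep b b' → LStep (f a b) (f a b')) {a a' b b' : Tm}
    (ha : Conv a a') (hb : Conv b b') : Conv (f a b) (f a' b') :=
  .trans _ _ _ (Conv.map (f := (f · b)) hl ha) (Conv.map (f := f a') hr hb)

theorem LStep.conv {m n : Tm} (h : LStep m n) : Conv m n := .rel _ _ h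

theorem PStep.conv {m n : Tm} (h : PStep m n) : Conv m n := by
  induction h with
  | var | srt | box | ptr => exact .refl _
  | pi0 _ _ ihA ihB => exact Conv.map₂ (f := .pi0 _) .pi0A .pi0B ihA ihB
  | pi1 _ _ ihA ihB => exact Conv.map₂ (f := .pi1 _) .pi1A .pi1B ihA ihB
  | lam0 _ _ ihA ihm => exact Conv.map₂ (f := .lam0 _) .lam0A .lam0M ihA ihm
  | lam1 _ _ ihA ihm => exact Conv.map₂ (f := .lam1 _) .lam1A .lam1M ihA ihm
  | app _ _ ihm ihn => exact Conv.map₂ (f := .app) .appL .appR ihm ihn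
  | beta0 _ _ ihm ihn =>
    exact .trans _ _ _ (Conv.map₂ (f := .app) .appL .appR (Conv.map .lam0M ihm) ihn)
      (.rel _ _ .beta0)
  | beta1 _ _ ihm ihn =>
    exact .trans _ _ _ (Conv.map₂ (f := .app) .appL .appR (Conv.map .lam1M ihm) ihn)
      (.rel _ _ .beta1)

theorem LStep.subst {m n : Tm} (h : LStep m n) :
    ∀ σ : Nat → Tm, LStep (subst σ m) (subst σ n) := by
  induction h with
  | beta0 => exact fun σ => by rw [subst_subst1]; exact .beta0
  | beta1 => exact fun σ => by rw [subst_subst1]; exact .beta1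
  | appL _ ih => exact fun σ => .appL (ih σ)
  | appR _ ih => exact fun σ => .appR (ih σ)
  | pi0A _ ih => exact fun σ => .pi0A (ih σ)
  | pi0B _ ih => exact fun σ => .pi0B (ih _)
  | pi1A _ ih => exact fun σ => .pi1A (ih σ)
  | pi1B _ ih => exact fun σ => .pi1B (ih _)
  | lam0A _ ih => exact fun σ => .lam0A (ih σ)
  | lam0M _ ih => exact fun σ => .lam0M (ih _)
  | lam1A _ ih => exact fun σ => .lam1A (ih σ)
  | lam1M _ ih => exact fun σ => .lam1M (ih _)

theorem Conv.subst {m n : Tm} (h : Conv m n) (σ : Nat → Tm) : Conv (subst σ m) (subst σ n) :=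
  h.map fun h => h.subst σ

theorem Conv.subst1 {B B' : Tm} (h : Conv B B') (n : Tm) : Conv (subst1 n B) (subst1 n B') :=
  h.subst _

theorem Conv.join {a b : Tm} (h : Conv a b) : Relation.Join (Relation.ReflTransGen PStep) a b := by
  have equiv : Equivalence (Relation.Join (Relation.ReflTransGen PStep)) :=
    Relation.equivalence_join_reflTransGen fun a _ _ hb hc =>
      ⟨develop a, .single hb.develop, .single hc.develop⟩
  induction h with
  | rel _ _ h => exact ⟨_, .single h.pstep, .refl⟩
  | refl => exact equiv.refl _
  | symm _ _ _ ih => exact equiv.symm ih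
  | trans _ _ _ _ _ ih₁ ih₂ => exact equiv.trans ih₁ ih₂

theorem pi0_of_red {t : Srt} {A B C : Tm} (h : Relation.ReflTransGen PStep (.pi0 t A B) C) :
    ∃ A' B', C = .pi0 t A' B' ∧ Conv A A' ∧ Conv B B' := by
  induction h with
  | refl => exact ⟨A, B, rfl, .refl _, .refl _⟩
  | tail _ h ih =>
    obtain ⟨A', B', rfl, hA, hB⟩ := ih
    cases h with
    | pi0 hA' hB' => exact ⟨_, _, rfl, hA.trans _ _ _ hA'.conv, hB.trans _ _ _ hB'.conv⟩

theorem pi1_of_red {t : Srt} {A B C : Tm} (h : Relation.ReflTransGen PStep (.pi1 t A B) C) :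
    ∃ A' B', C = .pi1 t A' B' ∧ Conv A A' ∧ Conv B B' := by
  induction h with
  | refl => exact ⟨A, B, rfl, .refl _, .refl _⟩
  | tail _ h ih =>
    obtain ⟨A', B', rfl, hA, hB⟩ := ih
    cases h with
    | pi1 hA' hB' => exact ⟨_, _, rfl, hA.trans _ _ _ hA'.conv, hB.trans _ _ _ hB'.conv⟩

theorem Conv.pi0_inj {t t' : Srt} {A A' B B' : Tm} (h : Conv (.pi0 t A B) (.pi0 t' A' B')) :
    Conv A A' ∧ Conv B B' := by
  obtain ⟨C, h₁, h₂⟩ := h.join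
  obtain ⟨A₁, B₁, rfl, hA₁, hB₁⟩ := pi0_of_red h₁
  obtain ⟨A₂, B₂, e, hA₂, hB₂⟩ := pi0_of_red h₂
  cases e
  exact ⟨hA₁.trans _ _ _ (hA₂.symm _ _), hB₁.trans _ _ _ (hB₂.symm _ _)⟩

theorem Conv.pi1_inj {t t' : Srt} {A A' B B' : Tm} (h : Conv (.pi1 t A B) (.pi1 t' A' B')) :
    Conv A A' ∧ Conv B B' := by
  obtain ⟨C, h₁, h₂⟩ := h.join
  obtain ⟨A₁, B₁, rfl, hA₁, hB₁⟩ := pi1_of_red h₁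
  obtain ⟨A₂, B₂, e, hA₂, hB₂⟩ := pi1_of_red h₂
  cases e
  exact ⟨hA₁.trans _ _ _ (hA₂.symm _ _), hB₁.trans _ _ _ (hB₂.symm _ _)⟩

theorem not_conv_pi0_pi1 {t t' : Srt} {A A' B B' : Tm} :
    ¬ Conv (.pi0 t A B) (.pi1 t' A' B') := by
  intro h
  obtain ⟨C, h₁, h₂⟩ := h.join
  obtain ⟨A₁, B₁, rfl, -, -⟩ := pi0_of_red h₁
  obtain ⟨A₂, B₂, e, -, -⟩ := pi1_of_red h₂
  cases e

/-! ### Structural properties of typing -/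

theorem LTyped.wf {Γ : Ctx} {m A : Tm} : LTyped Γ m A → LWf Γ
  | .srt _ h | .var h _ => h
  | .pi0 _ h _ | .pi1 _ h _ | .app0 h _ | .app1 h _ | .conv h _ _ => h.wf
  | .lam0 _ h | .lam1 _ h => by
    have := h.wf
    cases this
    assumption

theorem LWf.head {Γ : Ctx} {A : Tm} : LWf (A :: Γ) → ∃ s, LTyped Γ A (.srt s)
  | .cons _ h => ⟨_, h⟩

/-- Typing is preserved by every class `M` of context morphisms that sends variables to well-typed
terms and is closed under extension. -/
theorem LTyped.subst_of_morphism (M : Ctx → Ctx → (Nat → Tm) → Prop)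
    (hvar : ∀ {Γ Δ σ x A}, M Γ Δ σ → LWf Δ → Has Γ x A → LTyped Δ (σ x) (subst σ A))
    (hup : ∀ {Γ Δ σ A s}, M Γ Δ σ → LTyped Δ (subst σ A) (.srt s) →
      M (A :: Γ) (subst σ A :: Δ) (up σ))
    {Γ Δ : Ctx} {σ : Nat → Tm} {m A : Tm} (h : LTyped Γ m A) (hσ : M Γ Δ σ) (hΔ : LWf Δ) :
    LTyped Δ (subst σ m) (subst σ A) := by
  let Q (Γ : Ctx) (m A : Tm) : Prop :=
    ∀ {Δ σ}, M Γ Δ σ → LWf Δ → LTyped Δ (subst σ m) (subst σ A)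
  -- A λ has no premise typing its domain, so the induction also carries the types in the context.
  let W (Γ : Ctx) : Prop := ∀ {A Γ'}, A :: Γ' <:+ Γ → ∃ s, Q Γ' A (.srt s)
  have W_tail {A : Tm} {Γ : Ctx} (h : W (A :: Γ)) : W Γ :=
    fun hs => h (hs.trans (List.suffix_cons _ _))
  have Q_body {Γ : Ctx} {A s m B} (hA : Q Γ A (.srt s)) (hm : Q (A :: Γ) m B) {Δ σ}
      (hσ : M Γ Δ σ) (hΔ : LWf Δ) :
      LTyped (subst σ A :: Δ) (subst (up σ) m) (subst (up σ) B) :=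
    hm (hup hσ (hA hσ hΔ)) (.cons hΔ (hA hσ hΔ))
  suffices W Γ ∧ Q Γ m A from this.2 hσ hΔ
  clear hσ hΔ
  refine LTyped.rec (motive_1 := fun Γ _ => W Γ) (motive_2 := fun Γ m A _ => W Γ ∧ Q Γ m A)
    ?nil ?cons ?srt ?var ?pi0 ?pi1 ?lam0 ?lam1 ?app0 ?app1 ?conv h
  case nil =>
    intro A Γ' hs
    simp at hs
  case cons =>
    intro Γ B s _ _ hW ih A Γ' hs
    rcases List.suffix_cons_iff.1 hs with e | hs
    · cases e
      exact ⟨s, ih.2⟩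
    · exact hW hs
  case srt => exact fun s _ hW => ⟨hW, fun _ hΔ => .srt s hΔ⟩
  case var => exact fun _ hx hW => ⟨hW, fun hσ hΔ => hvar hσ hΔ hx⟩
  case pi0 =>
    exact fun t _ _ ihA ihB =>
      ⟨ihA.1, fun hσ hΔ => .pi0 t (ihA.2 hσ hΔ) (Q_body ihA.2 ihB.2 hσ hΔ)⟩
  case pi1 =>
    exact fun t _ _ ihA ihB =>
      ⟨ihA.1, fun hσ hΔ => .pi1 t (ihA.2 hσ hΔ) (Q_body ihA.2 ihB.2 hσ hΔ)⟩
  case lam0 =>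
    intro Γ A B m t _ ih
    obtain ⟨s, hA⟩ := ih.1 (List.suffix_refl _)
    exact ⟨W_tail ih.1, fun hσ hΔ => .lam0 t (Q_body hA ih.2 hσ hΔ)⟩
  case lam1 =>
    intro Γ A B m t _ ih
    obtain ⟨s, hA⟩ := ih.1 (List.suffix_refl _)
    exact ⟨W_tail ih.1, fun hσ hΔ => .lam1 t (Q_body hA ih.2 hσ hΔ)⟩
  case app0 =>
    exact fun _ _ ihm ihn => ⟨ihm.1, fun hσ hΔ => by
      rw [subst_subst1]; exact .app0 (ihm.2 hσ hΔ) (ihn.2 hσ hΔ)⟩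
  case app1 =>
    exact fun _ _ ihm ihn => ⟨ihm.1, fun hσ hΔ => by
      rw [subst_subst1]; exact .app1 (ihm.2 hσ hΔ) (ihn.2 hσ hΔ)⟩
  case conv =>
    exact fun _ _ hc ihm ihB =>
      ⟨ihm.1, fun hσ hΔ => .conv (ihm.2 hσ hΔ) (ihB.2 hσ hΔ) (hc.subst _)⟩

theorem LTyped.rename {Γ Δ : Ctx} {ξ : Nat → Nat} {m A : Tm} (h : LTyped Γ m A)
    (hξ : ∀ {x B}, Has Γ x B → Has Δ (ξ x) (rename ξ B)) (hΔ : LWf Δ) :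
    LTyped Δ (rename ξ m) (rename ξ A) := by
  simp only [rename_eq_subst _ ξ]
  refine h.subst_of_morphism (fun Γ Δ σ => ∃ ξ : Nat → Nat, σ = (fun x => .var (ξ x)) ∧
    ∀ {x B}, Has Γ x B → Has Δ (ξ x) (TLL.rename ξ B)) ?_ ?_ ⟨ξ, rfl, hξ⟩ hΔ
  · rintro Γ Δ _ x A ⟨ξ, rfl, hξ⟩ hΔ hx
    rw [← rename_eq_subst]
    exact .var hΔ (hξ hx)
  · rintro Γ Δ _ A s ⟨ξ, rfl, hξ⟩ -
    refine ⟨upr ξ, up_var_comp ξ, ?_⟩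
    intro x B hx
    rw [← rename_eq_subst]
    cases hx with
    | zero =>
      have : TLL.rename (upr ξ) (TLL.rename Nat.succ A) = TLL.rename Nat.succ (TLL.rename ξ A) := by
        simp only [rename_rename, upr]
      rw [this]
      exact .zero
    | @succ _ x B _ hx =>
      have : TLL.rename (upr ξ) (TLL.rename Nat.succ B) = TLL.rename Nat.succ (TLL.rename ξ B) := by
        simp only [rename_rename, upr]
      rw [this]
      exact .succ (hξ hx)

theorem LTyped.weaken {Γ : Ctx} {m A B : Tm} {s : Srt} (h : LTyped Γ m A)
    (hB : LTyped Γ B (.srt s)) : LTyped (B :: Γ) (TLL.rename Nat.succ m) (TLL.rename Nat.succ A) :=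
  h.rename .succ (.cons hB.wf hB)

theorem subst_up_rename_succ (σ : Nat → Tm) (A : Tm) :
    subst (up σ) (rename Nat.succ A) = rename Nat.succ (subst σ A) := by
  simp only [subst_rename, rename_subst, up]

theorem LTyped.subst {Γ Δ : Ctx} {σ : Nat → Tm} {m A : Tm} (h : LTyped Γ m A)
    (hσ : ∀ {x B}, Has Γ x B → LTyped Δ (σ x) (subst σ B)) (hΔ : LWf Δ) :
    LTyped Δ (subst σ m) (subst σ A) := by
  refine h.subst_of_morphism
    (fun Γ Δ σ => ∀ {x B}, Has Γ x B → LTyped Δ (σ x) (TLL.subst σ B)) ?_ ?_ hσ hΔ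
  · exact fun hσ _ hx => hσ hx
  · intro Γ Δ σ A s hσ hA x B hx
    cases hx with
    | zero =>
      rw [subst_up_rename_succ]
      exact .var (.cons hA.wf hA) .zero
    | succ hx =>
      rw [subst_up_rename_succ]
      exact (hσ hx).weaken hA

theorem LTyped.subst1 {Γ : Ctx} {m n A B : Tm} (hm : LTyped (A :: Γ) m B) (hn : LTyped Γ n A) :
    LTyped Γ (subst1 n m) (subst1 n B) := by
  refine hm.subst (σ := scons n) (fun hx => ?_) hn.wf
  cases hx with
  | zero =>
    rw [← subst1_eq, subst1_rename_succ]
    exact hn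
  | succ hx =>
    rw [← subst1_eq, subst1_rename_succ]
    exact .var hn.wf hx

theorem LTyped.conv_ctx {Γ : Ctx} {m A A' B : Tm} {s : Srt} (hm : LTyped (A :: Γ) m B)
    (hA' : LTyped Γ A' (.srt s)) (hc : Conv A' A) : LTyped (A' :: Γ) m B := by
  have hΔ : LWf (A' :: Γ) := .cons hA'.wf hA'
  obtain ⟨r, hA⟩ := hm.wf.head
  rw [← subst_var m, ← subst_var B]
  refine hm.subst (fun hx => ?_) hΔ
  rw [subst_var]
  cases hx with
  | zero =>
    refine .conv (.var hΔ .zero) (hA.weaken hA') ?_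
    simpa only [rename_eq_subst] using hc.subst _
  | succ hx => exact .var hΔ (.succ hx)

/-! ### Inversion and validity -/

/-- The premises from which a typing of a compound term `m` must have been derived, up to
conversion of its type. -/
def Inversion (Γ : Ctx) (m T : Tm) : Prop :=
  match m with
  | .pi0 t A B => ∃ s r, LTyped Γ A (.srt s) ∧ LTyped (A :: Γ) B (.srt r) ∧ Conv (.srt t) T
  | .pi1 t A B => ∃ s r, LTyped Γ A (.srt s) ∧ LTyped (A :: Γ) B (.srt r) ∧ Conv (.srt t) T
  | .lam0 t A m => ∃ B, LTyped (A :: Γ) m B ∧ Conv (.pi0 t A B) T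
  | .lam1 t A m => ∃ B, LTyped (A :: Γ) m B ∧ Conv (.pi1 t A B) T
  | .app m n => ∃ t A B, (LTyped Γ m (.pi0 t A B) ∨ LTyped Γ m (.pi1 t A B)) ∧
      LTyped Γ n A ∧ Conv (subst1 n B) T
  | _ => True

theorem Inversion.conv {Γ : Ctx} {m T T' : Tm} (h : Inversion Γ m T) (hc : Conv T T') :
    Inversion Γ m T' := by
  cases m with
  | pi0 | pi1 =>
    obtain ⟨s, r, hA, hB, hc'⟩ := h
    exact ⟨s, r, hA, hB, hc'.trans _ _ _ hc⟩
  | lam0 | lam1 =>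
    obtain ⟨B, hm, hc'⟩ := h
    exact ⟨B, hm, hc'.trans _ _ _ hc⟩
  | app =>
    obtain ⟨t, A, B, hm, hn, hc'⟩ := h
    exact ⟨t, A, B, hm, hn, hc'.trans _ _ _ hc⟩
  | _ => trivial

theorem LTyped.inversion {Γ : Ctx} {m T : Tm} : LTyped Γ m T → Inversion Γ m T
  | .srt _ _ | .var _ _ => trivial
  | .pi0 _ hA hB | .pi1 _ hA hB => ⟨_, _, hA, hB, .refl _⟩
  | .lam0 _ hm | .lam1 _ hm => ⟨_, hm, .refl _⟩
  | .app0 hm hn => ⟨_, _, _, .inl hm, hn, .refl _⟩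
  | .app1 hm hn => ⟨_, _, _, .inr hm, hn, .refl _⟩
  | .conv h _ hc => h.inversion.conv hc

theorem Has.valid {Γ : Ctx} {x : Nat} {A : Tm} (hx : Has Γ x A) :
    LWf Γ → ∃ s, LTyped Γ A (.srt s) := by
  induction hx with
  | zero => exact fun | .cons _ hA => ⟨_, hA.weaken hA⟩
  | succ _ ih =>
    exact fun | .cons hΓ hB => let ⟨s, hA⟩ := ih hΓ; ⟨s, hA.weaken hB⟩

theorem LTyped.valid {Γ : Ctx} {m A : Tm} : LTyped Γ m A → ∃ s, LTyped Γ A (.srt s)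
  | .srt _ h => ⟨_, .srt _ h⟩
  | .var h hx => hx.valid h
  | .pi0 _ hA _ | .pi1 _ hA _ => ⟨_, .srt _ hA.wf⟩
  | .lam0 t h =>
    let ⟨_, hA⟩ := h.wf.head
    let ⟨_, hB⟩ := h.valid
    ⟨t, .pi0 t hA hB⟩
  | .lam1 t h =>
    let ⟨_, hA⟩ := h.wf.head
    let ⟨_, hB⟩ := h.valid
    ⟨t, .pi1 t hA hB⟩
  | .app0 hm hn =>
    let ⟨_, hP⟩ := hm.valid
    let ⟨_, r, _, hB, _⟩ := hP.inversion
    ⟨r, hB.subst1 hn⟩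
  | .app1 hm hn =>
    let ⟨_, hP⟩ := hm.valid
    let ⟨_, r, _, hB, _⟩ := hP.inversion
    ⟨r, hB.subst1 hn⟩
  | .conv _ hB _ => ⟨_, hB⟩

theorem LTyped.app_of_or {Γ : Ctx} {m n A B : Tm} {t : Srt}
    (hm : LTyped Γ m (.pi0 t A B) ∨ LTyped Γ m (.pi1 t A B)) (hn : LTyped Γ n A) :
    LTyped Γ (.app m n) (TLL.subst1 n B) :=
  hm.elim (.app0 · hn) (.app1 · hn)

/-- Typing of a contractum, given that its domain and codomain agree with those of the redex. -/
theorem LTyped.contract {Γ : Ctx} {m n A A' B B' : Tm} (hm : LTyped (A' :: Γ) m B')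
    (hn : LTyped Γ n A) (hA : Conv A' A) (hB : Conv B' B) {T : Tm} {s : Srt}
    (hT : LTyped Γ T (.srt s)) (hc : Conv (TLL.subst1 n B) T) : LTyped Γ (TLL.subst1 n m) T :=
  let ⟨_, hA'⟩ := hm.wf.head
  .conv (hm.subst1 (.conv hn hA' (hA.symm _ _))) hT ((hB.subst1 n).trans _ _ _ hc)

/-- Logical subject reduction. -/
theorem logical_subject_reduction {Γ : Ctx} {m n A : Tm}
    (h : LTyped Γ m A) (hr : LStep m n) :
    LTyped Γ n A := by
  obtain ⟨s, hA⟩ := h.valid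
  induction hr generalizing Γ A s with
  | beta0 =>
    obtain ⟨t, D, C, hm, hn, hc⟩ := h.inversion
    obtain hm | hm := hm <;> obtain ⟨B, hb, hc'⟩ := hm.inversion
    · exact hb.contract hn hc'.pi0_inj.1 hc'.pi0_inj.2 hA hc
    · exact absurd hc' not_conv_pi0_pi1
  | beta1 =>
    obtain ⟨t, D, C, hm, hn, hc⟩ := h.inversion
    obtain hm | hm := hm <;> obtain ⟨B, hb, hc'⟩ := hm.inversion
    · exact absurd (hc'.symm _ _) not_conv_pi0_pi1
    · exact hb.contract hn hc'.pi1_inj.1 hc'.pi1_inj.2 hA hc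
  | appL _ ih =>
    obtain ⟨t, D, C, hm, hn, hc⟩ := h.inversion
    have hm' := hm.imp (fun hm => ih hm _ hm.valid.choose_spec)
      (fun hm => ih hm _ hm.valid.choose_spec)
    exact .conv (.app_of_or hm' hn) hA hc
  | appR hr ih =>
    obtain ⟨t, D, C, hm, hn, hc⟩ := h.inversion
    have hC := ((PStep.refl C).subst1 hr.pstep).conv
    exact .conv (.app_of_or hm (ih hn _ hn.valid.choose_spec)) hA ((hC.symm _ _).trans _ _ _ hc)
  | pi0A hr ih =>
    obtain ⟨_, _, hD, hB, hc⟩ := h.inversion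
    have hD' := ih hD _ hD.valid.choose_spec
    exact .conv (.pi0 _ hD' (hB.conv_ctx hD' (hr.conv.symm _ _))) hA hc
  | pi0B _ ih =>
    obtain ⟨_, _, hD, hB, hc⟩ := h.inversion
    exact .conv (.pi0 _ hD (ih hB _ hB.valid.choose_spec)) hA hc
  | pi1A hr ih =>
    obtain ⟨_, _, hD, hB, hc⟩ := h.inversion
    have hD' := ih hD _ hD.valid.choose_spec
    exact .conv (.pi1 _ hD' (hB.conv_ctx hD' (hr.conv.symm _ _))) hA hc
  | pi1B _ ih =>
    obtain ⟨_, _, hD, hB, hc⟩ := h.inversion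
    exact .conv (.pi1 _ hD (ih hB _ hB.valid.choose_spec)) hA hc
  | lam0A hr ih =>
    obtain ⟨B, hm, hc⟩ := h.inversion
    obtain ⟨_, hD⟩ := hm.wf.head
    have hr' := hr.conv.symm _ _
    have hm' := hm.conv_ctx (ih hD _ hD.valid.choose_spec) hr'
    exact .conv (.lam0 _ hm') hA ((Conv.map .pi0A hr').trans _ _ _ hc)
  | lam0M _ ih =>
    obtain ⟨B, hm, hc⟩ := h.inversion
    exact .conv (.lam0 _ (ih hm _ hm.valid.choose_spec)) hA hc
  | lam1A hr ih =>
    obtain ⟨B, hm, hc⟩ := h.inversion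
    obtain ⟨_, hD⟩ := hm.wf.head
    have hr' := hr.conv.symm _ _
    have hm' := hm.conv_ctx (ih hD _ hD.valid.choose_spec) hr'
    exact .conv (.lam1 _ hm') hA ((Conv.map .pi1A hr').trans _ _ _ hc)
  | lam1M _ ih =>
    obtain ⟨B, hm, hc⟩ := h.inversion
    exact .conv (.lam1 _ (ih hm _ hm.valid.choose_spec)) hA hc
end TLL
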